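/- Uniform convergence of the discrete solution operators implies convergence of the eigenvalues: if ‖T_n − T‖ → 0 in operator norm as n → ∞, then for every μ in the spectrum of T there exists a sequence (μ_n) with μ_n in the spectrum of T_n for each n and μ_n → μ. -/

import Mathlib

open Filter Topology

/-- The spectrum of an element `b` of a C⋆-algebra lies within distance `‖b - a‖` of the spectrum
of any normal element `a`. -/
theorem IsStarNormal.exists_mem_spectrum_norm_sub_le {A : Type*} [CStarAlgebra A] [Nontrivial A]
    (a b : A) [IsStarNormal a] {μ : ℂ} (hμ : μ ∈ spectrum ℂ b) :
    ∃ ν ∈ spectrum ℂ a, ‖ν - μ‖ ≤ ‖b - a‖ := by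
  by_contra! h
  have hne : ∀ ν ∈ spectrum ℂ a, μ - ν ≠ 0 := by
    intro ν hν h0
    have := h ν hν
    rw [norm_sub_rev ν, h0, norm_zero] at this
    exact (norm_nonneg _).not_gt this
  have hba : 0 < ‖b - a‖ := by
    rw [norm_pos_iff, sub_ne_zero]
    rintro rfl
    exact hne μ hμ (sub_self μ)
  have hcont : ContinuousOn (fun ν : ℂ => (μ - ν)⁻¹) (spectrum ℂ a) :=
    (by fun_prop : ContinuousOn (fun ν : ℂ => μ - ν) _).inv₀ hne
  have hunit : IsUnit (algebraMap ℂ A μ - a) := by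
    by_contra hu
    exact hne μ hu (sub_self μ)
  obtain ⟨u, hu⟩ := hunit
  have hsub : cfc (fun ν : ℂ => μ - ν) a = u := by
    rw [hu, cfc_sub (fun _ => μ) (fun ν => ν) a, cfc_const μ a, cfc_id' ℂ a]
  have hinv : cfc (fun ν : ℂ => (μ - ν)⁻¹) a = (u⁻¹ : Aˣ) := by
    refine Units.eq_inv_of_mul_eq_one_right ?_
    rw [← hsub, ← cfc_mul (fun ν : ℂ => (μ - ν)⁻¹) (fun ν => μ - ν) a hcont (by fun_prop),
      ← cfc_const_one ℂ a]
    exact cfc_congr fun ν hν => inv_mul_cancel₀ (hne ν hν)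
  have hlt : ‖((u⁻¹ : Aˣ) : A)‖ < ‖b - a‖⁻¹ := by
    rw [← hinv]
    refine norm_cfc_lt (inv_pos.2 hba) fun ν hν => ?_
    rw [norm_inv, norm_sub_rev]
    exact inv_strictAnti₀ hba (h ν hν)
  refine hμ (u.ofNearby (algebraMap ℂ A μ - b) ?_).isUnit
  rw [hu, sub_sub_sub_cancel_left, norm_sub_rev]
  exact (lt_inv_comm₀ (Units.norm_pos _) hba).1 hlt

/-- Uniform convergence of the discrete solution operators implies
convergence of the eigenvalues: if `‖Tn n - T‖ → 0`, then every `μ` in the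
spectrum of `T` is the limit of a sequence `μn` with `μn n ∈ spectrum (Tn n)`. -/
theorem spectrum_approximated_of_opNorm_tendsto
    {H : Type*} [NormedAddCommGroup H] [InnerProductSpace ℂ H]
    [CompleteSpace H] [Nontrivial H]
    (T : H →L[ℂ] H) (hT : IsSelfAdjoint T)
    (Tn : ℕ → H →L[ℂ] H) (hTn : ∀ n, IsSelfAdjoint (Tn n))
    (hconv : Tendsto (fun n => ‖Tn n - T‖) atTop (𝓝 0)) :
    ∀ μ ∈ spectrum ℂ T, ∃ μn : ℕ → ℂ,
      (∀ n, μn n ∈ spectrum ℂ (Tn n)) ∧ Tendsto μn atTop (𝓝 μ) := by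
  intro μ hμ
  have key : ∀ n, ∃ ν ∈ spectrum ℂ (Tn n), ‖ν - μ‖ ≤ ‖T - Tn n‖ := fun n =>
    have := (hTn n).isStarNormal
    IsStarNormal.exists_mem_spectrum_norm_sub_le (Tn n) T hμ
  choose μn hmem hle using key
  refine ⟨μn, hmem, tendsto_iff_norm_sub_tendsto_zero.2 ?_⟩
  exact squeeze_zero (fun _ => norm_nonneg _)
    (fun n => (hle n).trans_eq (norm_sub_rev _ _)) hconv
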